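/- Let V be an n-dimensional real vector space, let S ∈ End(Λ V) be the grading involution (the algebra automorphism of Λ V induced by −id_V, acting as (−1)^k on Λᵏ V), and define the supertrace of A ∈ End(Λ V) by str A = Tr(S ∘ A). If the top-degree (degree-n) homogeneous component of ω ∈ Λ V is zero, or the top-degree component of η ∈ Λ V* is zero, then str(Φ(ω ⊗ η)) = 0. (This is the vanishing content of the paper's local supertrace formula: the supertrace of a quantized symbol is, up to a universal normalization, the Berezin integral of the symbol, i.e., it depends only on the coefficient of the top monomial in all odd variables.) -/

import Mathlib

noncomputable section

open ExteriorAlgebra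

variable (V : Type*) [AddCommGroup V] [Module ℝ V]

/-- Left exterior multiplication `m(ω) = ω ∧ ·`, as a linear map
`Λ V →ₗ End(Λ V)`. -/
def extMul : ExteriorAlgebra ℝ V →ₗ[ℝ] Module.End ℝ (ExteriorAlgebra ℝ V) :=
  LinearMap.mul ℝ (ExteriorAlgebra ℝ V)

/-- Interior product (left contraction) by a covector `f ∈ V*`, as an
endomorphism of `Λ V`. -/
def interiorProd : Module.Dual ℝ V →ₗ[ℝ] Module.End ℝ (ExteriorAlgebra ℝ V) :=
  CliffordAlgebra.contractLeft

lemma interiorProd_sq_zero (f : Module.Dual ℝ V) :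
    interiorProd V f * interiorProd V f = 0 :=
  LinearMap.ext fun x => CliffordAlgebra.contractLeft_contractLeft f x

/-- The unique algebra homomorphism `c : Λ V* → End(Λ V)` with `c(f) = ι_f`
for every `f ∈ V*`. -/
def contr : ExteriorAlgebra ℝ (Module.Dual ℝ V) →ₐ[ℝ] Module.End ℝ (ExteriorAlgebra ℝ V) :=
  ExteriorAlgebra.lift ℝ ⟨interiorProd V, interiorProd_sq_zero V⟩

/-- The fermionic (normal-ordered) quantization map at a point:
`Φ(ω ⊗ η) = m(ω) ∘ c(η)`. -/
def fermionicQuant :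
    TensorProduct ℝ (ExteriorAlgebra ℝ V) (ExteriorAlgebra ℝ (Module.Dual ℝ V)) →ₗ[ℝ]
      Module.End ℝ (ExteriorAlgebra ℝ V) :=
  TensorProduct.lift
    (((LinearMap.mul ℝ (Module.End ℝ (ExteriorAlgebra ℝ V))).compl₂
        (contr V).toLinearMap).comp (extMul V))

/-- The grading involution `S` of `Λ V`: the algebra automorphism induced by
`−id_V`, acting as `(−1)^k` on `Λᵏ V`. -/
def gradingInvolution : ExteriorAlgebra ℝ V →ₐ[ℝ] ExteriorAlgebra ℝ V :=
  ExteriorAlgebra.map (-LinearMap.id : V →ₗ[ℝ] V)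

/-- The supertrace of an endomorphism of `Λ V`: `str A = Tr(S ∘ A)`. -/
def superTrace (A : Module.End ℝ (ExteriorAlgebra ℝ V)) : ℝ :=
  LinearMap.trace ℝ (ExteriorAlgebra ℝ V) ((gradingInvolution V).toLinearMap ∘ₗ A)

lemma gi_ι (v : V) : gradingInvolution V (ι ℝ v) = -ι ℝ v := by
  simp [gradingInvolution]

lemma gi_gi (x : ExteriorAlgebra ℝ V) : gradingInvolution V (gradingInvolution V x) = x := by
  have : (gradingInvolution V).comp (gradingInvolution V) = AlgHom.id ℝ _ := by
    apply ExteriorAlgebra.hom_ext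
    ext v
    simp [gi_ι]
  exact DFunLike.congr_fun this x

/-- Left Clifford-style induction. -/
lemma ext_ind {P : ExteriorAlgebra ℝ V → Prop} (h0 : ∀ r, P (algebraMap ℝ _ r))
    (ha : ∀ x y, P x → P y → P (x + y)) (hm : ∀ v x, P x → P (ι ℝ v * x)) (x) : P x :=
  CliffordAlgebra.left_induction (Q := (0 : QuadraticForm ℝ V)) h0 ha (fun x v h => hm v x h) x

lemma ip_ι_mul (f : Module.Dual ℝ V) (v : V) (x : ExteriorAlgebra ℝ V) :
    interiorProd V f (ι ℝ v * x) = f v • x - ι ℝ v * interiorProd V f x :=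
  CliffordAlgebra.contractLeft_ι_mul (Q := (0 : QuadraticForm ℝ V)) f v x

lemma ip_algebraMap (f : Module.Dual ℝ V) (r : ℝ) :
    interiorProd V f (algebraMap ℝ _ r) = 0 :=
  CliffordAlgebra.contractLeft_algebraMap (Q := (0 : QuadraticForm ℝ V)) f r

lemma ι_mul_eq (v : V) (x : ExteriorAlgebra ℝ V) :
    ι ℝ v * x = gradingInvolution V x * ι ℝ v := by
  induction x using ext_ind with
  | h0 r => simp [Algebra.commutes]
  | ha x y hx hy => simp [mul_add, add_mul, hx, hy]
  | hm w x hx =>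
    have h : ι ℝ v * ι ℝ w = -(ι ℝ w * ι ℝ v) :=
      eq_neg_of_add_eq_zero_left (ExteriorAlgebra.ι_add_mul_swap v w)
    rw [map_mul, gi_ι, mul_assoc, ← hx, ← mul_assoc, h, neg_mul, neg_mul, mul_assoc]

lemma ip_gi (f : Module.Dual ℝ V) (x : ExteriorAlgebra ℝ V) :
    gradingInvolution V (interiorProd V f x) = - interiorProd V f (gradingInvolution V x) := by
  induction x using ext_ind with
  | h0 r => simp [ip_algebraMap]
  | ha x y hx hy => simp only [map_add, hx, hy, neg_add]
  | hm w x hx => simp [ip_ι_mul, gi_ι, hx]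

lemma ip_mul (f : Module.Dual ℝ V) (x y : ExteriorAlgebra ℝ V) :
    interiorProd V f (x * y) =
      interiorProd V f x * y + gradingInvolution V x * interiorProd V f y := by
  induction x using ext_ind with
  | h0 r => simp [ip_algebraMap, ← Algebra.smul_def]
  | ha x z hx hy => simp only [map_add, add_mul, hx, hy]; abel
  | hm w x hx =>
    rw [mul_assoc, ip_ι_mul, ip_ι_mul, hx, map_mul, gi_ι]
    simp only [mul_add, sub_mul, smul_mul_assoc, neg_mul, mul_assoc]
    abel

/-- The grading involution as an element of the endomorphism algebra. -/
def giE : Module.End ℝ (ExteriorAlgebra ℝ V) := (gradingInvolution V).toLinearMap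

lemma eneg_mul (A B : Module.End ℝ (ExteriorAlgebra ℝ V)) : (-A) * B = -(A * B) :=
  LinearMap.ext fun _ => rfl

lemma emul_neg (A B : Module.End ℝ (ExteriorAlgebra ℝ V)) : A * (-B) = -(A * B) :=
  LinearMap.ext fun x => map_neg A (B x)

lemma giE_sq : giE V * giE V = 1 := LinearMap.ext (gi_gi V)

lemma giE_extMul (x : ExteriorAlgebra ℝ V) :
    giE V * extMul V x = extMul V (gradingInvolution V x) * giE V :=
  LinearMap.ext fun y => map_mul (gradingInvolution V) x y

lemma extMul_mul (x y : ExteriorAlgebra ℝ V) : extMul V (x * y) = extMul V x * extMul V y :=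
  LinearMap.ext fun z => mul_assoc x y z

lemma contr_ι (f : Module.Dual ℝ V) : contr V (ι ℝ f) = interiorProd V f := by
  simp [contr]

lemma giE_ip (f : Module.Dual ℝ V) : giE V * interiorProd V f = -(interiorProd V f * giE V) :=
  LinearMap.ext fun y => ip_gi V f y

lemma giE_contr (x : ExteriorAlgebra ℝ (Module.Dual ℝ V)) :
    giE V * contr V x = contr V (gradingInvolution _ x) * giE V := by
  induction x using ext_ind with
  | h0 r => simp only [AlgHom.commutes]; exact (Algebra.commutes r _).symm
  | ha x y hx hy => simp only [map_add, mul_add, add_mul, hx, hy]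
  | hm w x hx =>
    rw [map_mul, map_mul, map_mul, gi_ι, map_neg, contr_ι, ← mul_assoc, giE_ip, eneg_mul,
      mul_assoc, hx]
    simp only [eneg_mul, mul_assoc]

lemma ip_extMul (f : Module.Dual ℝ V) (x : ExteriorAlgebra ℝ V) :
    interiorProd V f * extMul V x =
      extMul V (interiorProd V f x) + extMul V (gradingInvolution V x) * interiorProd V f :=
  LinearMap.ext fun y => ip_mul V f x y

lemma extMul_contr (v : V) (x : ExteriorAlgebra ℝ (Module.Dual ℝ V)) :
    extMul V (ι ℝ v) * contr V x =
      contr V (interiorProd _ (Module.Dual.eval ℝ V v) x)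
        + contr V (gradingInvolution _ x) * extMul V (ι ℝ v) := by
  induction x using ext_ind with
  | h0 r =>
    rw [ip_algebraMap, map_zero, zero_add]; simp only [AlgHom.commutes]
    exact (Algebra.commutes r _).symm
  | ha x y hx hy => simp only [map_add, mul_add, add_mul, hx, hy]; abel
  | hm f x hx =>
    have h : extMul V (ι ℝ v) * interiorProd V f
        = f v • (1 : Module.End ℝ (ExteriorAlgebra ℝ V))
          - interiorProd V f * extMul V (ι ℝ v) := by
      refine LinearMap.ext fun y => ?_
      have := ip_ι_mul V f v y
      change ι ℝ v * interiorProd V f y = f v • y - interiorProd V f (ι ℝ v * y)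
      rw [this]; abel
    rw [map_mul, contr_ι, ← mul_assoc, h, sub_mul, mul_assoc, hx, ip_ι_mul, map_mul, gi_ι,
      map_sub, map_mul, map_smul, map_mul, map_neg, contr_ι]
    simp only [mul_add, smul_mul_assoc, one_mul, eneg_mul, mul_assoc, Module.Dual.eval_apply]
    abel

lemma fq_apply (ω : ExteriorAlgebra ℝ V) (η : ExteriorAlgebra ℝ (Module.Dual ℝ V)) :
    superTrace V (fermionicQuant V (ω ⊗ₜ[ℝ] η)) =
      LinearMap.trace ℝ _ (giE V * (extMul V ω * contr V η)) := rfl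

lemma stepA (f : Module.Dual ℝ V) (ω : ExteriorAlgebra ℝ V)
    (η : ExteriorAlgebra ℝ (Module.Dual ℝ V)) :
    LinearMap.trace ℝ _ (giE V * (extMul V (interiorProd V f ω) * contr V η)) = 0 := by
  have h1 : extMul V (interiorProd V f ω) = interiorProd V f * extMul V ω
      - extMul V (gradingInvolution V ω) * interiorProd V f := by
    rw [ip_extMul]; abel
  have hη : contr V η * interiorProd V f
      = interiorProd V f * contr V (gradingInvolution _ η) := by
    rw [← contr_ι, ← map_mul, ← map_mul, ι_mul_eq, gi_gi]
  have e1 : giE V * (interiorProd V f * extMul V ω * contr V η) =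
      -(interiorProd V f * (giE V * (extMul V ω * contr V η))) := by
    simp only [← mul_assoc, giE_ip, eneg_mul]
  have e2 : giE V * (extMul V (gradingInvolution V ω) * interiorProd V f * contr V η)
      = -((extMul V ω * (interiorProd V f * contr V (gradingInvolution _ η))) * giE V) := by
    rw [← mul_assoc, ← mul_assoc, giE_extMul, gi_gi, mul_assoc (extMul V ω), giE_ip,
      mul_assoc, eneg_mul, mul_assoc (interiorProd V f), giE_contr]
    simp only [emul_neg, mul_assoc]
  rw [h1, sub_mul, mul_sub, map_sub, e1, e2, map_neg, map_neg,
    LinearMap.trace_mul_comm ℝ (interiorProd V f), LinearMap.trace_mul_comm ℝ _ (giE V),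
    mul_assoc, mul_assoc, hη]
  abel

lemma stepB (v : V) (ω : ExteriorAlgebra ℝ V)
    (η : ExteriorAlgebra ℝ (Module.Dual ℝ V)) :
    LinearMap.trace ℝ _ (giE V *
      (extMul V ω * contr V (interiorProd _ (Module.Dual.eval ℝ V v) η))) = 0 := by
  have h1 : contr V (interiorProd _ (Module.Dual.eval ℝ V v) η) =
      extMul V (ι ℝ v) * contr V η - contr V (gradingInvolution _ η) * extMul V (ι ℝ v) := by
    rw [extMul_contr]; abel
  have hv : extMul V (ι ℝ v) * giE V = -(giE V * extMul V (ι ℝ v)) := by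
    rw [giE_extMul, gi_ι, map_neg, eneg_mul, neg_neg]
  have hω : extMul V (ι ℝ v) * extMul V ω
      = extMul V (gradingInvolution V ω) * extMul V (ι ℝ v) := by
    rw [← extMul_mul, ι_mul_eq, extMul_mul]
  have e : extMul V (ι ℝ v) * (giE V * (extMul V ω * contr V (gradingInvolution _ η)))
      = (extMul V ω * (extMul V (ι ℝ v) * contr V η)) * giE V := by
    have hη := giE_contr V (gradingInvolution _ η)
    rw [gi_gi] at hη
    rw [← mul_assoc, hv, eneg_mul, mul_assoc, ← mul_assoc (extMul V (ι ℝ v)), hω, mul_assoc,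
      ← mul_assoc (giE V), giE_extMul, gi_gi, mul_assoc, ← mul_assoc (giE V), giE_extMul, gi_ι,
      map_neg, mul_assoc (- _), hη]
    simp only [emul_neg, eneg_mul, neg_neg, mul_assoc]
  rw [h1, mul_sub, mul_sub, map_sub, ← mul_assoc (extMul V ω) (contr V _),
    ← mul_assoc (giE V) (_ * _) (extMul V (ι ℝ v)),
    LinearMap.trace_mul_comm ℝ _ (extMul V (ι ℝ v)), e, LinearMap.trace_mul_comm ℝ _ (giE V),
    sub_self]

lemma euler {κ : Type*} [Fintype κ] (b : Module.Basis κ ℝ V) (k : ℕ) (x : ExteriorAlgebra ℝ V)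
    (hx : x ∈ ⋀[ℝ]^k V) :
    ∑ i, ι ℝ (b i) * interiorProd V (b.coord i) x = (k : ℝ) • x := by
  induction hx using Submodule.pow_induction_on_left' with
  | algebraMap r => simp [ip_algebraMap]
  | add x y i hx hy h1 h2 => simp only [map_add, mul_add, Finset.sum_add_distrib, h1, h2, smul_add]
  | mem_mul m hm i x hx ih =>
    obtain ⟨v, rfl⟩ := hm
    have hv : ∑ i, b.coord i v • ι ℝ (b i) = ι ℝ v := by
      conv_rhs => rw [← b.sum_repr v]
      rw [map_sum]
      exact Finset.sum_congr rfl fun i _ => (map_smul _ _ _).symm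
    have : ∀ j, ι ℝ (b j) * interiorProd V (b.coord j) (ι ℝ v * x)
        = (b.coord j v • ι ℝ (b j)) * x
          + ι ℝ v * (ι ℝ (b j) * interiorProd V (b.coord j) x) := by
      intro j
      have h : ι ℝ (b j) * ι ℝ v = -(ι ℝ v * ι ℝ (b j)) :=
        eq_neg_of_add_eq_zero_left (ExteriorAlgebra.ι_add_mul_swap _ _)
      rw [ip_ι_mul, mul_sub, ← mul_assoc, h, mul_smul_comm, smul_mul_assoc, neg_mul, mul_assoc]
      abel
    simp only [this]
    rw [Finset.sum_add_distrib, ← Finset.sum_mul, hv, ← Finset.mul_sum, ih, mul_smul_comm]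
    push_cast
    rw [add_smul, one_smul, add_comm]

lemma vanish [FiniteDimensional ℝ V] (T : ExteriorAlgebra ℝ V →ₗ[ℝ] ℝ)
    (hT : ∀ f x, T (interiorProd V f x) = 0) (ω : ExteriorAlgebra ℝ V)
    (h : GradedAlgebra.proj (fun i : ℕ => ⋀[ℝ]^i V) (Module.finrank ℝ V) ω = 0) : T ω = 0 := by
  classical
  have key : ∀ k x, x ∈ ⋀[ℝ]^k V → k ≠ Module.finrank ℝ V → T x = 0 := by
    intro k x hx hk
    let b := Module.finBasis ℝ V
    have e := euler V b k x hx
    have e2 : ∑ i, interiorProd V (b.coord i) (ι ℝ (b i) * x)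
        = ((Module.finrank ℝ V : ℝ) - k) • x := by
      simp only [ip_ι_mul, Finset.sum_sub_distrib, e]
      simp [sub_smul, Nat.cast_smul_eq_nsmul]
    have e3 := congrArg T e2
    rw [map_sum, map_smul] at e3
    simp only [hT, Finset.sum_const_zero, smul_eq_mul] at e3
    have : ((Module.finrank ℝ V : ℝ) - k) ≠ 0 := by
      rw [sub_ne_zero]; exact_mod_cast hk.symm
    exact (mul_eq_zero.mp e3.symm).resolve_left this
  rw [← DirectSum.sum_support_decompose (fun i : ℕ => ⋀[ℝ]^i V) ω, map_sum]
  refine Finset.sum_eq_zero fun k _ => ?_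
  by_cases hk : k = Module.finrank ℝ V
  · subst hk
    rw [GradedAlgebra.proj_apply] at h
    rw [h, map_zero]
  · exact key k _ (SetLike.coe_mem _) hk

/-- If the top-degree (degree `n = dim V`) homogeneous component of
`ω ∈ Λ V` vanishes, or the top-degree component of `η ∈ Λ V*` vanishes, then the
supertrace of the quantized symbol vanishes: `str Φ(ω ⊗ η) = 0`. -/
theorem superTrace_fermionicQuant_eq_zero [FiniteDimensional ℝ V]
    (ω : ExteriorAlgebra ℝ V) (η : ExteriorAlgebra ℝ (Module.Dual ℝ V))
    (h : GradedAlgebra.proj (fun i : ℕ => ⋀[ℝ]^i V) (Module.finrank ℝ V) ω = 0 ∨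
      GradedAlgebra.proj (fun i : ℕ => ⋀[ℝ]^i (Module.Dual ℝ V))
        (Module.finrank ℝ V) η = 0) :
    superTrace V (fermionicQuant V (ω ⊗ₜ[ℝ] η)) = 0 := by
  rcases h with h | h
  · exact vanish V ((LinearMap.trace ℝ _).comp ((LinearMap.mulLeft ℝ (giE V)).comp
      ((LinearMap.mulRight ℝ (contr V η)).comp (extMul V)))) (fun f x => stepA V f x η) ω h
  · rw [← Subspace.dual_finrank_eq] at h
    refine vanish (Module.Dual ℝ V) ((LinearMap.trace ℝ _).comp ((LinearMap.mulLeft ℝ (giE V)).comp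
      ((LinearMap.mulLeft ℝ (extMul V ω)).comp (contr V).toLinearMap))) (fun F x => ?_) η h
    obtain ⟨v, rfl⟩ := (Module.evalEquiv ℝ V).surjective F
    exact stepB V v ω x

end
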